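/- Let a, b, c > 0 and τ ∈ ℕ with τ ≥ 1, set β = (1+b)^τ, suppose a > b·β and c·z₊ ≤ 1, where z₊ is the unique positive equilibrium. Let (z_t)_{t≥0} be a solution of the delay recurrence z_{t+1} = H(z_t, z_{t−τ+1}) with z_i > 0 for all i ∈ {0, …, τ−1}. Then for every t ≥ 0, min{z_0, z_1, …, z_{τ−1}, z₊} ≤ z_t ≤ max{z_0, z_1, …, z_{τ−1}, z₊}. -/

import Mathlib

/-- `Hfun a b c β u v = (1/m(u)) * (u + a·b·v/M(v))` where `m(x) = 1+b+cx` and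
`M(x) = bβ + (β-1)cx`. -/
noncomputable def Hfun (a b c β u v : ℝ) : ℝ :=
  (1 / (1 + b + c * u)) * (u + a * b * v / (b * β + (β - 1) * c * v))

/-- The positive equilibrium `z₊` of the delayed Beverton–Holt recurrence. -/
noncomputable def zplus (a b c β : ℝ) : ℝ :=
  (-(b * (2 * β - 1)) +
      Real.sqrt ((b * (2 * β - 1)) ^ 2 + 4 * b * (a - b * β) * (β - 1))) /
    (2 * c * (β - 1))

lemma zplus_spec (a b c β : ℝ) (hb : 0 < b) (hc : 0 < c) (hβ : 1 < β) (hab : b * β < a) :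
    0 < zplus a b c β ∧
    (b + c * zplus a b c β) * (b * β + (β - 1) * c * zplus a b c β) = a * b := by
  have h1 : 0 < β - 1 := by linarith
  have h2 : 0 < a - b * β := by linarith
  have hB : 0 < b * (2 * β - 1) := mul_pos hb (by linarith)
  have hpos : 0 < 4 * b * (a - b * β) * (β - 1) := by positivity
  have hlt : b * (2 * β - 1) <
      Real.sqrt ((b * (2 * β - 1)) ^ 2 + 4 * b * (a - b * β) * (β - 1)) := by
    apply Real.lt_sqrt_of_sq_lt
    linarith
  have hs := Real.sq_sqrt (show 0 ≤ (b * (2 * β - 1)) ^ 2 + 4 * b * (a - b * β) * (β - 1) by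
    positivity)
  unfold zplus
  generalize Real.sqrt ((b * (2 * β - 1)) ^ 2 + 4 * b * (a - b * β) * (β - 1)) = s at *
  refine ⟨div_pos (by linarith) (by positivity), ?_⟩
  have hne : β - 1 ≠ 0 := h1.ne'
  have e : c * ((-(b * (2 * β - 1)) + s) / (2 * c * (β - 1)))
      = (-(b * (2 * β - 1)) + s) / (2 * (β - 1)) := by
    field_simp
  rw [mul_assoc (β - 1) c, e]
  have e2 : (β - 1) * ((-(b * (2 * β - 1)) + s) / (2 * (β - 1)))
      = (-(b * (2 * β - 1)) + s) / 2 := by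
    field_simp
  rw [e2]
  have e3 : 2 * (β - 1) * ((-(b * (2 * β - 1)) + s) / (2 * (β - 1)))
      = -(b * (2 * β - 1)) + s := by
    field_simp
  generalize (-(b * (2 * β - 1)) + s) / (2 * (β - 1)) = y at *
  have h4 : 4 * (β - 1) ≠ 0 := by positivity
  apply mul_left_cancel₀ h4
  linear_combination (2 * (b * β + (-(b * (2 * β - 1)) + s) / 2)) * e3 + hs

lemma step_bound (a b c β p L U u v : ℝ) (hb : 0 < b) (hc : 0 < c) (hβ : 1 < β)
    (hp : 0 < p) (heq : (b + c * p) * (b * β + (β - 1) * c * p) = a * b) (hcp : c * p ≤ 1)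
    (hL : 0 < L) (hLp : L ≤ p) (hpU : p ≤ U)
    (hu : L ≤ u) (hu' : u ≤ U) (hv : L ≤ v) (hv' : v ≤ U) :
    L ≤ Hfun a b c β u v ∧ Hfun a b c β u v ≤ U := by
  have h1 : 0 < β - 1 := by linarith
  have hu0 : 0 < u := by linarith
  have hv0 : 0 < v := by linarith
  have hβ0 : 0 < β := by linarith
  have hM : 0 < b * β + (β - 1) * c * v := by positivity
  have hm : 0 < 1 + b + c * u := by positivity
  have hk : 0 < b + c * p := by positivity
  have hbβ : 0 < b * β := by positivity
  have hβc : 0 < (β - 1) * c * v := by positivity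
  have gU : a * b * v / (b * β + (β - 1) * c * v) ≤ U * (b + c * p) := by
    rw [div_le_iff₀ hM, ← heq]
    have : (b * β + (β - 1) * c * p) * v ≤ U * (b * β + (β - 1) * c * v) := by
      nlinarith [mul_le_mul_of_nonneg_left hv' hbβ.le, mul_le_mul_of_nonneg_left hpU hβc.le]
    nlinarith [mul_le_mul_of_nonneg_left this hk.le]
  have gL : L * (b + c * p) ≤ a * b * v / (b * β + (β - 1) * c * v) := by
    rw [le_div_iff₀ hM, ← heq]
    have : L * (b * β + (β - 1) * c * v) ≤ (b * β + (β - 1) * c * p) * v := by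
      nlinarith [mul_le_mul_of_nonneg_left hv hbβ.le, mul_le_mul_of_nonneg_left hLp hβc.le]
    nlinarith [mul_le_mul_of_nonneg_left this hk.le]
  unfold Hfun
  generalize a * b * v / (b * β + (β - 1) * c * v) = g at *
  have hcL : c * L ≤ c * p := mul_le_mul_of_nonneg_left hLp hc.le
  have hcU : c * p ≤ c * U := mul_le_mul_of_nonneg_left hpU hc.le
  have hU : 0 < U := by linarith
  rw [one_div_mul_eq_div, le_div_iff₀ hm, div_le_iff₀ hm]
  constructor
  · nlinarith [mul_nonneg (sub_nonneg.2 hu) (show 0 ≤ 1 - c * L by linarith),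
      mul_le_mul_of_nonneg_left hcL hL.le]
  · rcases le_total 1 (c * U) with h | h
    · nlinarith [mul_nonneg hu0.le (sub_nonneg.2 h), mul_le_mul_of_nonneg_left hcp hU.le]
    · nlinarith [mul_nonneg (sub_nonneg.2 hu') (sub_nonneg.2 h),
        mul_le_mul_of_nonneg_left hcU hU.le]

/-- Boundedness of solutions: if `a > b·β`, `c·z₊ ≤ 1`, and all initial
conditions are positive, then every iterate lies between
`min{z_0, …, z_{τ-1}, z₊}` and `max{z_0, …, z_{τ-1}, z₊}`. -/
theorem stmt13 (a b c : ℝ) (ha : 0 < a) (hb : 0 < b) (hc : 0 < c)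
    (τ : ℕ) (hτ : 1 ≤ τ) (hab : b * (1 + b) ^ τ < a)
    (hcz : c * zplus a b c ((1 + b) ^ τ) ≤ 1)
    (z : ℕ → ℝ) (hpos : ∀ i, i < τ → 0 < z i)
    (hrec : ∀ t, z (t + τ) = Hfun a b c ((1 + b) ^ τ) (z (t + τ - 1)) (z t)) :
    ∀ t,
      min ((Finset.range τ).inf' (Finset.nonempty_range_iff.mpr (by omega)) z)
          (zplus a b c ((1 + b) ^ τ)) ≤ z t ∧
      z t ≤ max ((Finset.range τ).sup' (Finset.nonempty_range_iff.mpr (by omega)) z)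
          (zplus a b c ((1 + b) ^ τ)) := by
  have hβ : 1 < (1 + b) ^ τ := one_lt_pow₀ (by linarith) (by omega)
  obtain ⟨hp, heq⟩ := zplus_spec a b c _ hb hc hβ hab
  generalize (1 + b) ^ τ = β at *
  generalize zplus a b c β = p at *
  intro t
  induction t using Nat.strong_induction_on with
  | _ t ih =>
    by_cases ht : t < τ
    · exact ⟨(min_le_left _ _).trans (Finset.inf'_le _ (Finset.mem_range.2 ht)),
        (Finset.le_sup' _ (Finset.mem_range.2 ht)).trans (le_max_left _ _)⟩
    · obtain ⟨s, rfl⟩ : ∃ s, t = s + τ := ⟨t - τ, by omega⟩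
      have i1 := ih (s + τ - 1) (by omega)
      have i2 := ih s (by omega)
      rw [hrec s]
      refine step_bound a b c β p _ _ _ _ hb hc hβ hp heq hcz ?_ (min_le_right _ _)
        (le_max_right _ _) i1.1 i1.2 i2.1 i2.2
      refine lt_min ?_ hp
      rw [Finset.lt_inf'_iff]
      intro i hi
      exact hpos i (Finset.mem_range.1 hi)
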